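/- arXiv:2504.17576 — 2 statements merged into one kernel-verified Lean document; each statement's English description precedes it below -/
import Mathlib

section
/- Let d, q ≥ 1, h > 0, c ∈ ℝ^d, let B : ℝ^d → ℝ^d be affine, let S : ℝ^d → M_{d,q}(ℝ) be convex with respect to the matrix partial order ⪯ (i.e. S(λx + (1−λ)y) ⪯ λS(x) + (1−λ)S(y) for all x, y ∈ ℝ^d and λ ∈ [0,1]) and of linear growth in operator norm (‖S(x)‖ ≤ K(1 + |x|) for some K > 0), and let φ : ℝ^d → ℝ be convex with linear growth. Then the function x ∈ ℝ^d ↦ ∫_{ℝ^q} φ(x + h·B(x) + √h·S(x) z + c) γ_q(dz) is convex and has linear growth. -/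
open MeasureTheory ProbabilityTheory

noncomputable section

/-- The standard Gaussian measure on `ℝ^q` (the law of `q` i.i.d. standard normals). -/
def stdGaussian (q : ℕ) : Measure (EuclideanSpace ℝ (Fin q)) :=
  (Measure.pi fun _ : Fin q => gaussianReal 0 1).map (EuclideanSpace.equiv (Fin q) ℝ).symm

/-- Matrix-vector product `u z` viewed between Euclidean spaces. -/
def matVec {d q : ℕ} (u : Matrix (Fin d) (Fin q) ℝ) (z : EuclideanSpace ℝ (Fin q)) :
    EuclideanSpace ℝ (Fin d) :=
  (EuclideanSpace.equiv (Fin d) ℝ).symm (u.mulVec (EuclideanSpace.equiv (Fin q) ℝ z))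

/-- The matrix partial order: `A ⪯ B` iff `B Bᵀ - A Aᵀ` is positive semidefinite. -/
def matLE {d q : ℕ} (A B : Matrix (Fin d) (Fin q) ℝ) : Prop :=
  (B * B.transpose - A * A.transpose).PosSemidef

/-- The operator norm of a `d × q` real matrix, `‖A‖ = sup_{|z| ≤ 1} |A z|`
(Euclidean norms on both sides). -/
def matOpNorm {d q : ℕ} (u : Matrix (Fin d) (Fin q) ℝ) : ℝ :=
  ‖LinearMap.toContinuousLinearMap (Matrix.toEuclideanLin u)‖

/-- Multiplication by a matrix as a continuous linear map between Euclidean spaces. -/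
def matCLM {d q : ℕ} (A : Matrix (Fin d) (Fin q) ℝ) :
    EuclideanSpace ℝ (Fin q) →L[ℝ] EuclideanSpace ℝ (Fin d) :=
  LinearMap.toContinuousLinearMap (Matrix.toEuclideanLin A)

lemma matVec_eq_matCLM {d q : ℕ} (A : Matrix (Fin d) (Fin q) ℝ) (z : EuclideanSpace ℝ (Fin q)) :
    matVec A z = matCLM A z := rfl

lemma matVec_combo {d q : ℕ} (A B : Matrix (Fin d) (Fin q) ℝ) (s t : ℝ)
    (z : EuclideanSpace ℝ (Fin q)) :
    matVec (s • A + t • B) z = s • matVec A z + t • matVec B z := by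
  simp [matVec_eq_matCLM, matCLM]

lemma stdGaussian_eq (q : ℕ) :
    stdGaussian q = ProbabilityTheory.stdGaussian (EuclideanSpace ℝ (Fin q)) :=
  map_pi_eq_stdGaussian

instance isGaussian_stdGaussian_euclidean (q : ℕ) : IsGaussian (stdGaussian q) := by
  rw [stdGaussian_eq]; infer_instance

open scoped Matrix in
lemma norm_sq_matCLM_transpose {d q : ℕ} (A : Matrix (Fin d) (Fin q) ℝ)
    (t : EuclideanSpace ℝ (Fin d)) :
    ‖matCLM A.transpose t‖ ^ 2 = t.ofLp ⬝ᵥ (A * A.transpose) *ᵥ t.ofLp := by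
  rw [← real_inner_self_eq_norm_sq, EuclideanSpace.inner_eq_star_dotProduct]
  simp [matCLM, ← Matrix.mulVec_mulVec, Matrix.dotProduct_mulVec, ← Matrix.mulVec_transpose]

lemma inner_matCLM_left {d q : ℕ} (A : Matrix (Fin d) (Fin q) ℝ)
    (z : EuclideanSpace ℝ (Fin q)) (t : EuclideanSpace ℝ (Fin d)) :
    inner ℝ (matCLM A z) t = inner ℝ z (matCLM A.transpose t) := by
  simp [EuclideanSpace.inner_eq_star_dotProduct, matCLM, Matrix.dotProduct_mulVec,
    Matrix.mulVec_transpose]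

/-- The image of the standard Gaussian measure under `A` is Gaussian with covariance `A Aᵀ`. -/
lemma map_matCLM_stdGaussian {d q : ℕ} (A : Matrix (Fin d) (Fin q) ℝ) :
    (stdGaussian q).map (matCLM A) = multivariateGaussian 0 (A * A.transpose) := by
  have hA : (A * A.transpose).PosSemidef := by
    simpa using Matrix.posSemidef_self_mul_conjTranspose A
  refine Measure.ext_of_charFun (funext fun t => ?_)
  have hmap : charFun ((stdGaussian q).map (matCLM A)) t
      = charFun (stdGaussian q) (matCLM A.transpose t) := by
    rw [charFun_apply, charFun_apply, integral_map (by fun_prop) (by fun_prop)]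
    simp_rw [inner_matCLM_left]
  rw [hmap, charFun_multivariateGaussian hA, stdGaussian_eq, charFun_stdGaussian,
    ← Complex.ofReal_pow, norm_sq_matCLM_transpose]
  congr 1
  simp [neg_div]

lemma multivariateGaussian_conv {d : ℕ} {P Q : Matrix (Fin d) (Fin d) ℝ}
    (hP : P.PosSemidef) (hQ : Q.PosSemidef) :
    (multivariateGaussian 0 P).conv (multivariateGaussian 0 Q)
      = multivariateGaussian 0 (P + Q) := by
  refine Measure.ext_of_charFun (funext fun t => ?_)
  rw [charFun_conv, charFun_multivariateGaussian hP, charFun_multivariateGaussian hQ,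
    charFun_multivariateGaussian (hP.add hQ), ← Complex.exp_add]
  congr 1
  simp [Matrix.add_mulVec]
  ring

/-- A continuous function of linear growth is integrable for a measure with finite first moment. -/
lemma integrable_of_linear_growth {E : Type*} [NormedAddCommGroup E] [MeasurableSpace E]
    [BorelSpace E] {μ : Measure E} [IsFiniteMeasure μ]
    (hμ : Integrable (fun z : E => ‖z‖) μ) {f : E → ℝ} (hf : Continuous f) {C : ℝ}
    (hC : ∀ z, |f z| ≤ C * (1 + ‖z‖)) : Integrable f μ :=
  (((integrable_const (1 : ℝ)).add hμ).const_mul C).mono' hf.aestronglyMeasurable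
    (Filter.Eventually.of_forall hC)

/-- Adding a centred independent noise increases the integral of a convex function. -/
lemma integral_le_integral_conv {E : Type*} [NormedAddCommGroup E] [NormedSpace ℝ E]
    [FiniteDimensional ℝ E] [MeasurableSpace E] [BorelSpace E]
    {μ ν : Measure E} [IsProbabilityMeasure μ] [IsProbabilityMeasure ν] {ψ : E → ℝ}
    (hψ : ConvexOn ℝ Set.univ ψ) (hψμ : Integrable ψ μ) (hψμν : Integrable ψ (μ.conv ν))
    (hψν : ∀ x, Integrable (fun y => ψ (x + y)) ν)
    (hν : Integrable (fun y => y) ν) (hν0 : ∫ y, y ∂ν = 0) :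
    ∫ x, ψ x ∂μ ≤ ∫ x, ψ x ∂(μ.conv ν) := by
  rw [integral_conv hψμν]
  have hint : Integrable (fun x => ∫ y, ψ (x + y) ∂ν) μ := by
    have h := (integrable_map_measure hψμν.aestronglyMeasurable (by fun_prop)).1 hψμν
    exact h.integral_prod_left
  refine integral_mono hψμ hint fun x => ?_
  have hJ := hψ.map_integral_le (μ := ν) (f := fun y => x + y)
    (hψ.continuousOn isOpen_univ) isClosed_univ (by simp)
    ((integrable_const x).add hν) (hψν x)
  rwa [integral_add (integrable_const x) hν, hν0, integral_const, probReal_univ, one_smul,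
    add_zero] at hJ

/-- Monotonicity of Gaussian integrals of convex functions with respect to `⪯`. -/
lemma integral_matVec_le_of_matLE {d q : ℕ} {A B : Matrix (Fin d) (Fin q) ℝ} (hAB : matLE A B)
    {ψ : EuclideanSpace ℝ (Fin d) → ℝ} (hψ : ConvexOn ℝ Set.univ ψ) {C : ℝ}
    (hC : ∀ x, |ψ x| ≤ C * (1 + ‖x‖)) :
    ∫ z, ψ (matVec A z) ∂(stdGaussian q) ≤ ∫ z, ψ (matVec B z) ∂(stdGaussian q) := by
  have hcont : Continuous ψ := continuousOn_univ.1 (hψ.continuousOn isOpen_univ)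
  have key (D : Matrix (Fin d) (Fin q) ℝ) : ∫ z, ψ (matVec D z) ∂(stdGaussian q)
      = ∫ w, ψ w ∂(multivariateGaussian 0 (D * D.transpose)) := by
    rw [← map_matCLM_stdGaussian, integral_map (by fun_prop) hcont.aestronglyMeasurable]
    rfl
  have hA : (A * A.transpose).PosSemidef := by
    simpa using Matrix.posSemidef_self_mul_conjTranspose A
  have hconv := multivariateGaussian_conv hA hAB
  rw [add_sub_cancel] at hconv
  have hint (P : Matrix (Fin d) (Fin d) ℝ) : Integrable ψ (multivariateGaussian 0 P) :=
    integrable_of_linear_growth IsGaussian.integrable_id.norm hcont hC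
  rw [key, key, ← hconv]
  refine integral_le_integral_conv hψ (hint _) (hconv ▸ hint _) (fun x => ?_)
    IsGaussian.integrable_id integral_id_multivariateGaussian
  have hC0 : 0 ≤ C := by simpa using (abs_nonneg _).trans (hC 0)
  refine integrable_of_linear_growth IsGaussian.integrable_id.norm (by fun_prop)
    (C := C * (1 + ‖x‖)) fun y => (hC _).trans ?_
  rw [mul_assoc]
  refine mul_le_mul_of_nonneg_left ?_ hC0
  nlinarith [norm_add_le x y, norm_nonneg x, norm_nonneg y,
    mul_nonneg (norm_nonneg x) (norm_nonneg y)]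

/-- An affine self-map of a finite-dimensional space has linear growth. -/
lemma exists_norm_le_of_affine {E : Type*} [NormedAddCommGroup E] [NormedSpace ℝ E]
    [FiniteDimensional ℝ E] {B : E → E}
    (hB : ∀ x y : E, ∀ t : ℝ, B (t • x + (1 - t) • y) = t • B x + (1 - t) • B y) :
    ∃ K, 0 ≤ K ∧ ∀ x, ‖B x‖ ≤ K * (1 + ‖x‖) := by
  have hsmul (t : ℝ) (x : E) : B (t • x) - B 0 = t • (B x - B 0) := by
    have := hB x 0 t
    rw [smul_zero, add_zero] at this
    rw [this]; module
  have hadd (x y : E) : B (x + y) - B 0 = (B x - B 0) + (B y - B 0) := by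
    have h1 := hB ((2 : ℝ) • x) ((2 : ℝ) • y) (1 / 2)
    have hx := hsmul 2 x
    have hy := hsmul 2 y
    rw [sub_eq_iff_eq_add] at hx hy
    rw [hx, hy, show (1 / 2 : ℝ) • (2 : ℝ) • x + (1 - 1 / 2 : ℝ) • (2 : ℝ) • y = x + y by module]
      at h1
    rw [h1]; module
  let L : E →ₗ[ℝ] E :=
    { toFun := fun x => B x - B 0
      map_add' := hadd
      map_smul' := hsmul }
  let L' : E →L[ℝ] E := LinearMap.toContinuousLinearMap L
  refine ⟨‖L'‖ + ‖B 0‖, by positivity, fun x => ?_⟩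
  have h1 : ‖B x - B 0‖ ≤ ‖L'‖ * ‖x‖ := L'.le_opNorm x
  have h2 : ‖B x‖ ≤ ‖B x - B 0‖ + ‖B 0‖ := by simpa using norm_add_le (B x - B 0) (B 0)
  nlinarith [norm_nonneg L', norm_nonneg (B 0), norm_nonneg x,
    mul_nonneg (norm_nonneg (B 0)) (norm_nonneg x)]

/-- Propagation of convexity through one Euler step: if `B` is affine, `S` is `⪯`-convex with
linear growth in operator norm, and `φ` is convex with linear growth, then
`x ↦ ∫ φ(x + h B(x) + √h S(x) z + c) γ_q(dz)` is convex with linear growth. -/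
theorem euler_step_preserves_convexity
    {d q : ℕ} (hd : 1 ≤ d) (hq : 1 ≤ q) (h : ℝ) (hh : 0 < h)
    (c : EuclideanSpace ℝ (Fin d))
    (B : EuclideanSpace ℝ (Fin d) → EuclideanSpace ℝ (Fin d))
    (hB : ∀ x y : EuclideanSpace ℝ (Fin d), ∀ t : ℝ,
      B (t • x + (1 - t) • y) = t • B x + (1 - t) • B y)
    (S : EuclideanSpace ℝ (Fin d) → Matrix (Fin d) (Fin q) ℝ)
    (hSconv : ∀ x y : EuclideanSpace ℝ (Fin d), ∀ t ∈ Set.Icc (0:ℝ) 1,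
      matLE (S (t • x + (1 - t) • y)) (t • S x + (1 - t) • S y))
    (hSgrowth : ∃ K > 0, ∀ x, matOpNorm (S x) ≤ K * (1 + ‖x‖))
    (φ : EuclideanSpace ℝ (Fin d) → ℝ)
    (hφconv : ConvexOn ℝ Set.univ φ)
    (hφgrowth : ∃ C > 0, ∀ x, |φ x| ≤ C * (1 + ‖x‖)) :
    ConvexOn ℝ Set.univ
      (fun x => ∫ z, φ (x + h • B x + Real.sqrt h • matVec (S x) z + c) ∂(stdGaussian q)) ∧
    ∃ C > 0, ∀ x,
      |∫ z, φ (x + h • B x + Real.sqrt h • matVec (S x) z + c) ∂(stdGaussian q)| ≤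
        C * (1 + ‖x‖) := by
  obtain ⟨K, hK, hS⟩ := hSgrowth
  obtain ⟨C, hC, hφ⟩ := hφgrowth
  obtain ⟨b, hb, hBb⟩ := exists_norm_le_of_affine hB
  have hcont : Continuous φ := continuousOn_univ.1 (hφconv.continuousOn isOpen_univ)
  have hs : 0 ≤ Real.sqrt h := Real.sqrt_nonneg h
  set s := Real.sqrt h
  have hmom : Integrable (fun z => ‖z‖) (stdGaussian q) := IsGaussian.integrable_id.norm
  have hgrow (x) (z : EuclideanSpace ℝ (Fin q)) :
      |φ (x + h • B x + s • matVec (S x) z + c)|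
        ≤ C * (2 + h * b + s * K + ‖c‖) * (1 + ‖x‖) * (1 + ‖z‖) := by
    refine (hφ _).trans ?_
    simp only [mul_assoc C]
    refine mul_le_mul_of_nonneg_left ?_ hC.le
    have h1 : ‖matVec (S x) z‖ ≤ K * (1 + ‖x‖) * ‖z‖ :=
      ((matCLM (S x)).le_opNorm z).trans (mul_le_mul_of_nonneg_right (hS x) (norm_nonneg z))
    have h2 : ‖x + h • B x + s • matVec (S x) z + c‖
        ≤ ‖x‖ + h * (b * (1 + ‖x‖)) + s * (K * (1 + ‖x‖) * ‖z‖) + ‖c‖ := by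
      refine norm_add₄_le.trans ?_
      rw [norm_smul, norm_smul, Real.norm_of_nonneg hh.le, Real.norm_of_nonneg hs]
      gcongr
      exact hBb x
    have hx := norm_nonneg x
    have hz := norm_nonneg z
    have hc := norm_nonneg c
    generalize ‖x‖ = X at *
    generalize ‖z‖ = Z at *
    generalize ‖c‖ = N at *
    have e : (2 + h * b + s * K + N) * (1 + X) * (1 + Z)
        - (1 + (X + h * (b * (1 + X)) + s * (K * (1 + X) * Z) + N))
        = (1 + X) * (1 + 2 * Z) + h * b * (1 + X) * Z + s * K * (1 + X)
          + N * (X + Z + X * Z) := by ring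
    have : 0 ≤ (1 + X) * (1 + 2 * Z) + h * b * (1 + X) * Z + s * K * (1 + X)
          + N * (X + Z + X * Z) := by positivity
    linarith
  have hint (x) : Integrable (fun z => φ (x + h • B x + s • matVec (S x) z + c))
      (stdGaussian q) := by
    refine integrable_of_linear_growth hmom ?_ (hgrow x)
    simp only [matVec_eq_matCLM]
    fun_prop
  refine ⟨⟨convex_univ, fun x _ y _ a a' ha ha' haa' => ?_⟩, ?_⟩
  · obtain rfl : a' = 1 - a := by linarith
    set m := a • x + (1 - a) • y
    have hψ : ConvexOn ℝ Set.univ (fun w => φ (m + h • B m + s • w + c)) := by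
      refine ⟨convex_univ, fun u _ v _ p r hp hr hpr => ?_⟩
      have := hφconv.2 (Set.mem_univ (m + h • B m + s • u + c))
        (Set.mem_univ (m + h • B m + s • v + c)) hp hr hpr
      obtain rfl : r = 1 - p := by linarith
      have e : m + h • B m + s • (p • u + (1 - p) • v) + c
          = p • (m + h • B m + s • u + c) + (1 - p) • (m + h • B m + s • v + c) := by module
      change φ (m + h • B m + s • (p • u + (1 - p) • v) + c) ≤ _
      rwa [e]
    have hψC (w) : |φ (m + h • B m + s • w + c)|
        ≤ C * (1 + ‖m + h • B m‖ + s + ‖c‖) * (1 + ‖w‖) := by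
      refine (hφ _).trans ?_
      simp only [mul_assoc C]
      refine mul_le_mul_of_nonneg_left ?_ hC.le
      have h2 : ‖m + h • B m + s • w + c‖ ≤ ‖m + h • B m‖ + s * ‖w‖ + ‖c‖ := by
        refine norm_add₃_le.trans ?_
        rw [norm_smul, Real.norm_of_nonneg hs]
      have hw := norm_nonneg w
      have : 0 ≤ ‖m + h • B m‖ * ‖w‖ + ‖c‖ * ‖w‖ := by positivity
      nlinarith
    refine (integral_matVec_le_of_matLE (hSconv x y a ⟨ha, by linarith⟩) hψ hψC).trans ?_
    simp only [smul_eq_mul]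
    rw [← integral_const_mul, ← integral_const_mul,
      ← integral_add ((hint x).const_mul a) ((hint y).const_mul (1 - a))]
    have hpt (z) : φ (m + h • B m + s • matVec (a • S x + (1 - a) • S y) z + c)
        ≤ a * φ (x + h • B x + s • matVec (S x) z + c)
          + (1 - a) * φ (y + h • B y + s • matVec (S y) z + c) := by
      have := hφconv.2 (Set.mem_univ (x + h • B x + s • matVec (S x) z + c))
        (Set.mem_univ (y + h • B y + s • matVec (S y) z + c)) ha ha' haa'
      simp only [smul_eq_mul] at this
      convert! this using 2
      rw [matVec_combo, hB x y a]
      module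
    refine integral_mono ?_ (((hint x).const_mul a).add ((hint y).const_mul (1 - a))) hpt
    refine integrable_of_linear_growth hmom ?_
      (C := C * (1 + ‖m + h • B m‖ + s + ‖c‖) * (1 + ‖matCLM (a • S x + (1 - a) • S y)‖))
      fun z => (hψC _).trans ?_
    · simp only [matVec_eq_matCLM]
      fun_prop
    · rw [mul_assoc _ (1 + ‖matCLM _‖)]
      refine mul_le_mul_of_nonneg_left ?_ (by positivity)
      rw [matVec_eq_matCLM]
      nlinarith [(matCLM (a • S x + (1 - a) • S y)).le_opNorm z, norm_nonneg z,
        norm_nonneg (matCLM (a • S x + (1 - a) • S y))]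
  · have hM : 0 ≤ ∫ z, (1 + ‖z‖) ∂(stdGaussian q) := integral_nonneg fun z => by positivity
    refine ⟨C * (2 + h * b + s * K + ‖c‖) * (∫ z, (1 + ‖z‖) ∂(stdGaussian q)) + 1,
      by positivity, fun x => ?_⟩
    have hbd : Integrable (fun z => C * (2 + h * b + s * K + ‖c‖) * (1 + ‖x‖) * (1 + ‖z‖))
        (stdGaussian q) := ((integrable_const 1).add hmom).const_mul _
    have hle := norm_integral_le_of_norm_le
      (f := fun z => φ (x + h • B x + s • matVec (S x) z + c)) hbd
      (Filter.Eventually.of_forall (hgrow x))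
    refine hle.trans ?_
    rw [integral_const_mul]
    nlinarith [norm_nonneg x]

end
end

section
/- (Properties of the backward recursion Φ.) In the Euler-scheme setup for X with assumptions (a)–(f) and with the backward functions Φ_m defined in the context from a convex function F : (ℝ^d)^{M+1} → ℝ with p-polynomial growth, the following hold for every m = 0, …, M: (i) for every fixed (μ_m, …, μ_M) ∈ P_p(ℝ^d)^{M−m+1}, the function (x₀, …, x_m) ↦ Φ_m(x₀,…,x_m; μ_m,…,μ_M) is finite, convex, and has p-polynomial growth (so that Φ_m is well defined); (ii) for every fixed (x₀, …, x_m) ∈ (ℝ^d)^{m+1}, Φ_m is non-decreasing in the measure arguments with respect to the convex order: if μ_i ⪯_cv ν_i for all i = m,…,M, then Φ_m(x₀,…,x_m; μ_m,…,μ_M) ≤ Φ_m(x₀,…,x_m; ν_m,…,ν_M). -/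
open MeasureTheory ProbabilityTheory

noncomputable section

instance matrixMeasurableSpace {d q : ℕ} : MeasurableSpace (Matrix (Fin d) (Fin q) ℝ) :=
  (inferInstance : MeasurableSpace (Fin d → Fin q → ℝ))

/-- A real-valued function on `ℝ^d` has linear growth if `|φ(x)| ≤ C (1 + |x|)`. -/
def LinGrowth {d : ℕ} (φ : EuclideanSpace ℝ (Fin d) → ℝ) : Prop :=
  ∃ C > 0, ∀ x, |φ x| ≤ C * (1 + ‖x‖)

/-- Convex order for measures on `ℝ^d`: `μ ⪯_cv ν` iff `∫ φ dμ ≤ ∫ φ dν` for every convex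
function `φ` of linear growth. -/
def CvOrder {d : ℕ} (μ ν : Measure (EuclideanSpace ℝ (Fin d))) : Prop :=
  ∀ φ : EuclideanSpace ℝ (Fin d) → ℝ, ConvexOn ℝ Set.univ φ → LinGrowth φ →
    ∫ x, φ x ∂μ ≤ ∫ x, φ x ∂ν

/-- `μ` is a probability measure on `ℝ^d` with finite `p`-th moment. -/
def MemPp {d : ℕ} (p : ℝ) (μ : Measure (EuclideanSpace ℝ (Fin d))) : Prop :=
  IsProbabilityMeasure μ ∧ (∫⁻ ξ, ENNReal.ofReal (‖ξ‖ ^ p) ∂μ) < ⊤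

/-- Codomains for the independence statement: the noises `Z m` and the pair `(X₀, Y₀)`. -/
def mixType (d q M : ℕ) : Fin M ⊕ Unit → Type
  | Sum.inl _ => EuclideanSpace ℝ (Fin q)
  | Sum.inr _ => EuclideanSpace ℝ (Fin d) × EuclideanSpace ℝ (Fin d)

def mixMS (d q M : ℕ) : ∀ i, MeasurableSpace (mixType d q M i)
  | Sum.inl _ => (inferInstance : MeasurableSpace (EuclideanSpace ℝ (Fin q)))
  | Sum.inr _ =>
      (inferInstance : MeasurableSpace (EuclideanSpace ℝ (Fin d) × EuclideanSpace ℝ (Fin d)))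

/-- The family consisting of the noises `Z m` together with the pair `(X₀, Y₀)`. -/
def mixFun {Ω : Type*} {d q M : ℕ} (X₀ Y₀ : Ω → EuclideanSpace ℝ (Fin d))
    (Z : Fin M → Ω → EuclideanSpace ℝ (Fin q)) : ∀ i, Ω → mixType d q M i
  | Sum.inl m => Z m
  | Sum.inr _ => fun ω => (X₀ ω, Y₀ ω)

section GaussianLaw

open scoped RealInnerProductSpace

lemma stdGaussian_eq_euclideanSpace (q : ℕ) :
    _root_.stdGaussian q = ProbabilityTheory.stdGaussian (EuclideanSpace ℝ (Fin q)) :=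
  map_pi_eq_stdGaussian

instance isGaussian_stdGaussian_fin (q : ℕ) : IsGaussian (_root_.stdGaussian q) := by
  rw [stdGaussian_eq_euclideanSpace]
  infer_instance

/-- `matVec u` as a continuous linear map. -/
def matVecCLM {d q : ℕ} (u : Matrix (Fin d) (Fin q) ℝ) :
    EuclideanSpace ℝ (Fin q) →L[ℝ] EuclideanSpace ℝ (Fin d) :=
  LinearMap.toContinuousLinearMap (Matrix.toEuclideanLin u)

lemma norm_matVec_le {d q : ℕ} (u : Matrix (Fin d) (Fin q) ℝ) (z : EuclideanSpace ℝ (Fin q)) :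
    ‖matVec u z‖ ≤ matOpNorm u * ‖z‖ :=
  (matVecCLM u).le_opNorm z

lemma matOpNorm_nonneg {d q : ℕ} (u : Matrix (Fin d) (Fin q) ℝ) : 0 ≤ matOpNorm u :=
  norm_nonneg _

lemma measurable_matVec {d q : ℕ} (u : Matrix (Fin d) (Fin q) ℝ) : Measurable (matVec u) :=
  (matVecCLM u).continuous.measurable

lemma matVec_add_smul {d q : ℕ} (u v : Matrix (Fin d) (Fin q) ℝ) (s t : ℝ)
    (z : EuclideanSpace ℝ (Fin q)) :
    matVec (s • u + t • v) z = s • matVec u z + t • matVec v z := by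
  simp only [matVec, Matrix.add_mulVec, Matrix.smul_mulVec, map_add, map_smul]

lemma inner_matVec {d q : ℕ} (u : Matrix (Fin d) (Fin q) ℝ) (z : EuclideanSpace ℝ (Fin q))
    (t : EuclideanSpace ℝ (Fin d)) : ⟪matVec u z, t⟫ = ⟪z, matVec u.transpose t⟫ := by
  simp only [EuclideanSpace.inner_eq_star_dotProduct, matVec, star_trivial]
  change t.ofLp ⬝ᵥ u.mulVec z.ofLp = (u.transpose.mulVec t.ofLp) ⬝ᵥ z.ofLp
  rw [Matrix.dotProduct_mulVec, Matrix.mulVec_transpose]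

lemma norm_sq_matVec_transpose {d q : ℕ} (u : Matrix (Fin d) (Fin q) ℝ)
    (t : EuclideanSpace ℝ (Fin d)) :
    ‖matVec u.transpose t‖ ^ 2 = t.ofLp ⬝ᵥ (u * u.transpose).mulVec t.ofLp := by
  rw [← real_inner_self_eq_norm_sq, ← inner_matVec, EuclideanSpace.inner_eq_star_dotProduct,
    star_trivial, ← Matrix.mulVec_mulVec]
  rfl

lemma charFun_map_matVec_stdGaussian {d q : ℕ} (u : Matrix (Fin d) (Fin q) ℝ)
    (t : EuclideanSpace ℝ (Fin d)) :
    charFun ((_root_.stdGaussian q).map (matVec u)) t =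
      Complex.exp (- (t.ofLp ⬝ᵥ (u * u.transpose).mulVec t.ofLp : ℝ) / 2) := by
  rw [charFun_apply, integral_map (measurable_matVec u).aemeasurable (by fun_prop)]
  simp_rw [inner_matVec]
  rw [← charFun_apply, stdGaussian_eq_euclideanSpace, charFun_stdGaussian,
    ← norm_sq_matVec_transpose]
  push_cast
  rfl

lemma map_matVec_conv_multivariateGaussian {d q : ℕ} {A B : Matrix (Fin d) (Fin q) ℝ}
    (hAB : matLE A B) :
    (_root_.stdGaussian q).map (matVec A) ∗
        multivariateGaussian 0 (B * B.transpose - A * A.transpose) =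
      (_root_.stdGaussian q).map (matVec B) := by
  have := Measure.isProbabilityMeasure_map (μ := _root_.stdGaussian q)
    (measurable_matVec A).aemeasurable
  have := Measure.isProbabilityMeasure_map (μ := _root_.stdGaussian q)
    (measurable_matVec B).aemeasurable
  apply Measure.ext_of_charFun
  ext t
  rw [charFun_conv, charFun_map_matVec_stdGaussian, charFun_map_matVec_stdGaussian,
    charFun_multivariateGaussian hAB, ← Complex.exp_add, Matrix.sub_mulVec, dotProduct_sub]
  congr 1
  simp
  ring

lemma measurePreserving_neg_multivariateGaussian {d : ℕ} {S : Matrix (Fin d) (Fin d) ℝ}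
    (hS : S.PosSemidef) :
    MeasurePreserving Neg.neg (multivariateGaussian 0 S) (multivariateGaussian 0 S) := by
  refine ⟨measurable_neg, ?_⟩
  have := Measure.isProbabilityMeasure_map (μ := multivariateGaussian 0 S)
    measurable_neg.aemeasurable
  apply Measure.ext_of_charFun
  ext t
  rw [charFun_apply, integral_map measurable_neg.aemeasurable (by fun_prop)]
  simp_rw [inner_neg_left, ← inner_neg_right]
  rw [← charFun_apply, charFun_multivariateGaussian hS, charFun_multivariateGaussian hS]
  simp [Matrix.mulVec_neg]

/-- The Gaussian law is monotone in its covariance matrix for the convex order. -/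
lemma integral_comp_matVec_le_of_matLE {d q : ℕ} {A B : Matrix (Fin d) (Fin q) ℝ}
    (hAB : matLE A B) {f : EuclideanSpace ℝ (Fin d) → ℝ} (hf : ConvexOn ℝ Set.univ f)
    (hfA : Integrable (fun z => f (matVec A z)) (_root_.stdGaussian q))
    (hfB : Integrable (fun z => f (matVec B z)) (_root_.stdGaussian q)) :
    ∫ z, f (matVec A z) ∂(_root_.stdGaussian q) ≤ ∫ z, f (matVec B z) ∂(_root_.stdGaussian q) := by
  set μ := (_root_.stdGaussian q).map (matVec A)
  set N := multivariateGaussian 0 (B * B.transpose - A * A.transpose)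
  have : IsProbabilityMeasure μ := Measure.isProbabilityMeasure_map
    (measurable_matVec A).aemeasurable
  have hfc : Continuous f := continuousOn_univ.1 (hf.continuousOn isOpen_univ)
  have hmap : (μ.prod N).map (fun w => w.1 + w.2) = (_root_.stdGaussian q).map (matVec B) :=
    map_matVec_conv_multivariateGaussian hAB
  have hadd : Measurable fun w : EuclideanSpace ℝ (Fin d) × EuclideanSpace ℝ (Fin d) =>
    w.1 + w.2 := by fun_prop
  have hint : Integrable (fun w : EuclideanSpace ℝ (Fin d) × EuclideanSpace ℝ (Fin d) =>
      f (w.1 + w.2)) (μ.prod N) := by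
    have hB : Integrable f ((μ.prod N).map (fun w => w.1 + w.2)) := by
      rw [hmap]
      exact (integrable_map_measure hfc.aestronglyMeasurable
        (measurable_matVec B).aemeasurable).2 hfB
    exact hB.comp_measurable hadd
  have heq : ∫ w, f (w.1 + w.2) ∂(μ.prod N) = ∫ z, f (matVec B z) ∂(_root_.stdGaussian q) := by
    rw [← integral_map (measurable_matVec B).aemeasurable hfc.aestronglyMeasurable, ← hmap,
      integral_map hadd.aemeasurable hfc.aestronglyMeasurable]
  have hneg : MeasurePreserving (Prod.map id Neg.neg) (μ.prod N) (μ.prod N) :=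
    (MeasurePreserving.id μ).prod (measurePreserving_neg_multivariateGaussian hAB)
  have hint' : Integrable (fun w : EuclideanSpace ℝ (Fin d) × EuclideanSpace ℝ (Fin d) =>
      f (w.1 - w.2)) (μ.prod N) := by
    simpa [Function.comp_def, sub_eq_add_neg] using
      (hneg.integrable_comp hint.aestronglyMeasurable).2 hint
  have heq' : ∫ w, f (w.1 - w.2) ∂(μ.prod N) = ∫ w, f (w.1 + w.2) ∂(μ.prod N) := by
    have hF : AEStronglyMeasurable
        (fun w : EuclideanSpace ℝ (Fin d) × EuclideanSpace ℝ (Fin d) => f (w.1 + w.2))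
        ((μ.prod N).map (Prod.map id Neg.neg)) := by
      rw [hneg.map_eq]
      exact hint.aestronglyMeasurable
    have := integral_map hneg.measurable.aemeasurable hF
    rw [hneg.map_eq] at this
    simpa [sub_eq_add_neg] using this.symm
  have hfst : MeasurePreserving Prod.fst (μ.prod N) μ := measurePreserving_fst
  have hfμ : Integrable f μ := (integrable_map_measure hfc.aestronglyMeasurable
    (measurable_matVec A).aemeasurable).2 hfA
  calc ∫ z, f (matVec A z) ∂(_root_.stdGaussian q)
      = ∫ x, f x ∂μ :=
        (integral_map (measurable_matVec A).aemeasurable hfc.aestronglyMeasurable).symm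
    _ = ∫ w, f w.1 ∂(μ.prod N) := by simp [integral_fun_fst]
    _ ≤ ∫ w, ((1 / 2 : ℝ) * f (w.1 + w.2) + (1 / 2 : ℝ) * f (w.1 - w.2)) ∂(μ.prod N) := by
        refine integral_mono ((hfst.integrable_comp hfc.aestronglyMeasurable).2 hfμ)
          ((hint.const_mul _).add (hint'.const_mul _)) fun w => ?_
        have h := hf.2 (Set.mem_univ (w.1 + w.2)) (Set.mem_univ (w.1 - w.2))
          (show (0 : ℝ) ≤ 1 / 2 by norm_num) (show (0 : ℝ) ≤ 1 / 2 by norm_num) (by norm_num)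
        have hw : (1 / 2 : ℝ) • (w.1 + w.2) + (1 / 2 : ℝ) • (w.1 - w.2) = w.1 := by module
        rwa [hw] at h
    _ = ∫ z, f (matVec B z) ∂(_root_.stdGaussian q) := by
        rw [integral_add (hint.const_mul _) (hint'.const_mul _), integral_const_mul,
          integral_const_mul, heq', heq]
        ring

end GaussianLaw

section Recursion

lemma one_add_rpow_le {p a : ℝ} (hp : 0 ≤ p) (ha : 0 ≤ a) :
    (1 + a) ^ p ≤ 2 ^ p * (1 + a ^ p) := by
  have hap : 0 ≤ a ^ p := Real.rpow_nonneg ha p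
  have h2 : (0 : ℝ) < 2 ^ p := by positivity
  rcases le_total a 1 with h | h
  · calc (1 + a) ^ p ≤ 2 ^ p := Real.rpow_le_rpow (by linarith) (by linarith) hp
      _ ≤ 2 ^ p * (1 + a ^ p) := by nlinarith
  · calc (1 + a) ^ p ≤ (2 * a) ^ p := Real.rpow_le_rpow (by linarith) (by linarith) hp
      _ = 2 ^ p * a ^ p := Real.mul_rpow (by norm_num) ha
      _ ≤ 2 ^ p * (1 + a ^ p) := by nlinarith

lemma integrable_one_add_norm_rpow_stdGaussian (q : ℕ) {p : ℝ} (hp : 0 < p) :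
    Integrable (fun z => (1 + ‖z‖) ^ p) (_root_.stdGaussian q) := by
  have h1 : MemLp (fun z : EuclideanSpace ℝ (Fin q) => 1 + ‖z‖) (ENNReal.ofReal p)
      (_root_.stdGaussian q) := by
    have hid : MemLp (fun z : EuclideanSpace ℝ (Fin q) => z) (ENNReal.ofReal p)
        (_root_.stdGaussian q) := IsGaussian.memLp_id _ _ ENNReal.ofReal_ne_top
    exact (memLp_const (1 : ℝ)).add hid.norm
  have h2 := h1.integrable_norm_rpow (by simpa using hp) ENNReal.ofReal_ne_top
  rw [ENNReal.toReal_ofReal hp.le] at h2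
  refine h2.congr (Filter.Eventually.of_forall fun z => ?_)
  simp only [Real.norm_eq_abs]
  rw [abs_of_nonneg (by positivity)]

variable {d q M : ℕ}

lemma le_iSup_norm_rpow (m : Fin (M + 1)) (x : Fin (M + 1) → EuclideanSpace ℝ (Fin d)) (p : ℝ)
    {i : Fin (M + 1)} (hi : i ≤ m) :
    ‖x i‖ ^ p ≤ ⨆ j : {j : Fin (M + 1) // j ≤ m}, ‖x j.1‖ ^ p :=
  le_ciSup (f := fun j : {j : Fin (M + 1) // j ≤ m} => ‖x j.1‖ ^ p)
    (Set.finite_range _).bddAbove ⟨i, hi⟩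

lemma iSup_norm_rpow_nonneg (m : Fin (M + 1)) (x : Fin (M + 1) → EuclideanSpace ℝ (Fin d))
    (p : ℝ) : 0 ≤ ⨆ j : {j : Fin (M + 1) // j ≤ m}, ‖x j.1‖ ^ p :=
  Real.iSup_nonneg fun _ => by positivity

lemma iSup_norm_rpow_update_le (m : Fin M) (x : Fin (M + 1) → EuclideanSpace ℝ (Fin d))
    (y : EuclideanSpace ℝ (Fin d)) (p : ℝ) :
    (⨆ j : {j : Fin (M + 1) // j ≤ m.succ}, ‖Function.update x m.succ y j.1‖ ^ p) ≤
      (⨆ j : {j : Fin (M + 1) // j ≤ m.castSucc}, ‖x j.1‖ ^ p) + ‖y‖ ^ p := by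
  have hS := iSup_norm_rpow_nonneg m.castSucc x p
  have hy : 0 ≤ ‖y‖ ^ p := by positivity
  have : Nonempty {j : Fin (M + 1) // j ≤ m.succ} := ⟨⟨m.succ, le_rfl⟩⟩
  refine ciSup_le fun j => ?_
  by_cases hj : j.1 = m.succ
  · rw [hj, Function.update_self]
    linarith
  · rw [Function.update_of_ne hj]
    have hle : j.1 ≤ m.castSucc := by
      have h1 := j.2
      simp only [Fin.le_def, Fin.ext_iff, Fin.val_succ, Fin.val_castSucc] at *
      omega
    linarith [le_iSup_norm_rpow m.castSucc x p hle]

/-- `p`-polynomial growth in the coordinates `x₀, …, x_m`. -/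
def GrowthUpTo (p : ℝ) (m : Fin (M + 1)) (G : (Fin (M + 1) → EuclideanSpace ℝ (Fin d)) → ℝ) :
    Prop :=
  ∃ C > 0, ∀ x, |G x| ≤ C * (1 + ⨆ i : {i : Fin (M + 1) // i ≤ m}, ‖x i.1‖ ^ p)

lemma abs_update_le_of_growth {p C : ℝ} (hp : 0 ≤ p) (hC : 0 < C) {m : Fin M}
    {G : (Fin (M + 1) → EuclideanSpace ℝ (Fin d)) → ℝ}
    (hG : ∀ x, |G x| ≤ C * (1 + ⨆ i : {i : Fin (M + 1) // i ≤ m.succ}, ‖x i.1‖ ^ p))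
    (x : Fin (M + 1) → EuclideanSpace ℝ (Fin d)) {y : EuclideanSpace ℝ (Fin d)} {R s : ℝ}
    (hR : 0 ≤ R) (hs : 0 ≤ s) (hy : ‖y‖ ≤ R * (1 + s)) :
    |G (Function.update x m.succ y)| ≤
      C * (1 + (⨆ i : {i : Fin (M + 1) // i ≤ m.castSucc}, ‖x i.1‖ ^ p) +
        R ^ p * (1 + s) ^ p) := by
  refine (hG _).trans (mul_le_mul_of_nonneg_left ?_ hC.le)
  have h1 := iSup_norm_rpow_update_le m x y p
  have h2 : ‖y‖ ^ p ≤ R ^ p * (1 + s) ^ p := by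
    rw [← Real.mul_rpow hR (by linarith)]
    exact Real.rpow_le_rpow (norm_nonneg _) hy hp
  linarith

lemma integrable_update_matVec {p : ℝ} (hp : 0 < p) {m : Fin M}
    {G : (Fin (M + 1) → EuclideanSpace ℝ (Fin d)) → ℝ} (hGconv : ConvexOn ℝ Set.univ G)
    (hG : GrowthUpTo p m.succ G) (x : Fin (M + 1) → EuclideanSpace ℝ (Fin d))
    (c e : EuclideanSpace ℝ (Fin d)) (r : ℝ) (u : Matrix (Fin d) (Fin q) ℝ) :
    Integrable (fun z => G (Function.update x m.succ (c + r • matVec u z + e)))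
      (_root_.stdGaussian q) := by
  obtain ⟨C, hC, hG⟩ := hG
  have hGc : Continuous G := continuousOn_univ.1 (hGconv.continuousOn isOpen_univ)
  have hu : Continuous (matVec u) := (matVecCLM u).continuous
  set R := ‖c‖ + ‖e‖ + |r| * matOpNorm u
  have hu0 := matOpNorm_nonneg u
  have hR : 0 ≤ R := by positivity
  have hmaj : Integrable (fun z =>
      C * (1 + (⨆ i : {i : Fin (M + 1) // i ≤ m.castSucc}, ‖x i.1‖ ^ p) +
        R ^ p * (1 + ‖z‖) ^ p)) (_root_.stdGaussian q) :=
    ((integrable_const _).add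
      ((integrable_one_add_norm_rpow_stdGaussian q hp).const_mul _)).const_mul _
  refine hmaj.mono' ?_ (Filter.Eventually.of_forall fun z => ?_)
  · refine (hGc.comp (continuous_const.update _ ?_)).aestronglyMeasurable
    fun_prop
  · refine abs_update_le_of_growth hp.le hC hG x hR (norm_nonneg z) ?_
    have h1 : ‖c + r • matVec u z + e‖ ≤ ‖c‖ + |r| * (matOpNorm u * ‖z‖) + ‖e‖ := by
      refine norm_add₃_le.trans ?_
      rw [norm_smul, Real.norm_eq_abs]
      gcongr
      exact norm_matVec_le u z
    have hz := norm_nonneg z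
    have hcz : 0 ≤ ‖c‖ * ‖z‖ := by positivity
    have hez : 0 ≤ ‖e‖ * ‖z‖ := by positivity
    have hru : 0 ≤ |r| * matOpNorm u := by positivity
    simp only [R]
    nlinarith

lemma update_convexComb (x y : Fin (M + 1) → EuclideanSpace ℝ (Fin d)) (s : Fin (M + 1))
    (v w : EuclideanSpace ℝ (Fin d)) (a b : ℝ) :
    Function.update (a • x + b • y) s (a • v + b • w) =
      a • Function.update x s v + b • Function.update y s w := by
  ext1 i
  by_cases hi : i = s
  · subst hi
    simp
  · simp [Function.update_of_ne hi]

lemma integral_update_matVec_le_of_matLE {p : ℝ} (hp : 0 < p) {m : Fin M}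
    {G : (Fin (M + 1) → EuclideanSpace ℝ (Fin d)) → ℝ} (hGconv : ConvexOn ℝ Set.univ G)
    (hG : GrowthUpTo p m.succ G) (x : Fin (M + 1) → EuclideanSpace ℝ (Fin d))
    (c e : EuclideanSpace ℝ (Fin d)) (r : ℝ) {u v : Matrix (Fin d) (Fin q) ℝ} (huv : matLE u v) :
    ∫ z, G (Function.update x m.succ (c + r • matVec u z + e)) ∂(_root_.stdGaussian q) ≤
      ∫ z, G (Function.update x m.succ (c + r • matVec v z + e)) ∂(_root_.stdGaussian q) := by
  refine integral_comp_matVec_le_of_matLE huv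
    (f := fun w => G (Function.update x m.succ (c + r • w + e))) ⟨convex_univ, ?_⟩
    (integrable_update_matVec hp hGconv hG x c e r u)
    (integrable_update_matVec hp hGconv hG x c e r v)
  intro w₁ _ w₂ _ a b ha hb hab
  have hx : a • x + b • x = x := by rw [← add_smul, hab, one_smul]
  have hcomb : c + r • (a • w₁ + b • w₂) + e =
      a • (c + r • w₁ + e) + b • (c + r • w₂ + e) := by
    obtain rfl : b = 1 - a := by linarith
    module
  have := hGconv.2 (Set.mem_univ (Function.update x m.succ (c + r • w₁ + e)))
    (Set.mem_univ (Function.update x m.succ (c + r • w₂ + e))) ha hb hab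
  rwa [← update_convexComb, hx, ← hcomb] at this

/-- The one-step backward operator of the Euler scheme, with drift `β`, diffusion `s` and
common-noise increment `e`, preserves convexity. -/
lemma convexOn_integral_update_matVec {p : ℝ} (hp : 0 < p) {m : Fin M}
    {G : (Fin (M + 1) → EuclideanSpace ℝ (Fin d)) → ℝ} (hGconv : ConvexOn ℝ Set.univ G)
    (hG : GrowthUpTo p m.succ G)
    {β : EuclideanSpace ℝ (Fin d) → EuclideanSpace ℝ (Fin d)}
    (hβ : ∀ x y : EuclideanSpace ℝ (Fin d), ∀ t : ℝ,
      β (t • x + (1 - t) • y) = t • β x + (1 - t) • β y)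
    {s : EuclideanSpace ℝ (Fin d) → Matrix (Fin d) (Fin q) ℝ}
    (hs : ∀ x y : EuclideanSpace ℝ (Fin d), ∀ t ∈ Set.Icc (0 : ℝ) 1,
      matLE (s (t • x + (1 - t) • y)) (t • s x + (1 - t) • s y))
    (h r : ℝ) (e : EuclideanSpace ℝ (Fin d)) :
    ConvexOn ℝ Set.univ fun x => ∫ z, G (Function.update x m.succ
      (x m.castSucc + h • β (x m.castSucc) + r • matVec (s (x m.castSucc)) z + e))
      ∂(_root_.stdGaussian q) := by
  refine ⟨convex_univ, fun x _ y _ a b ha hb hab => ?_⟩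
  obtain rfl : b = 1 - a := by linarith
  have hint := fun x : Fin (M + 1) → EuclideanSpace ℝ (Fin d) => integrable_update_matVec hp hGconv
    hG x (x m.castSucc + h • β (x m.castSucc)) e r (s (x m.castSucc))
  refine (integral_update_matVec_le_of_matLE hp hGconv hG _ _ e r
    (hs (x m.castSucc) (y m.castSucc) a ⟨ha, by linarith⟩)).trans ?_
  simp only [smul_eq_mul]
  rw [← integral_const_mul, ← integral_const_mul,
    ← integral_add ((hint x).const_mul _) ((hint y).const_mul _)]
  refine integral_mono (integrable_update_matVec hp hGconv hG _ _ e r _)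
    (((hint x).const_mul _).add ((hint y).const_mul _)) fun z => ?_
  have hcomb : (a • x + (1 - a) • y) m.castSucc + h • β ((a • x + (1 - a) • y) m.castSucc) +
      r • matVec (a • s (x m.castSucc) + (1 - a) • s (y m.castSucc)) z + e =
      a • (x m.castSucc + h • β (x m.castSucc) + r • matVec (s (x m.castSucc)) z + e) +
      (1 - a) • (y m.castSucc + h • β (y m.castSucc) + r • matVec (s (y m.castSucc)) z + e) := by
    rw [matVec_add_smul, Pi.add_apply, Pi.smul_apply, Pi.smul_apply, hβ]
    module
  simp only
  rw [hcomb, update_convexComb]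
  exact hGconv.2 (Set.mem_univ _) (Set.mem_univ _) ha hb hab

/-- The one-step backward operator of the Euler scheme preserves `p`-polynomial growth. -/
lemma growthUpTo_integral_update_matVec {p : ℝ} (hp : 0 < p) {m : Fin M}
    {G : (Fin (M + 1) → EuclideanSpace ℝ (Fin d)) → ℝ}
    (hG : GrowthUpTo p m.succ G)
    {β : EuclideanSpace ℝ (Fin d) → EuclideanSpace ℝ (Fin d)}
    {s : EuclideanSpace ℝ (Fin d) → Matrix (Fin d) (Fin q) ℝ} {K : ℝ} (hK : 0 ≤ K)
    (hβ : ∀ x, ‖β x‖ ≤ K * (1 + ‖x‖)) (hs : ∀ x, matOpNorm (s x) ≤ K * (1 + ‖x‖))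
    (h r : ℝ) (e : EuclideanSpace ℝ (Fin d)) :
    GrowthUpTo p m.castSucc fun x => ∫ z, G (Function.update x m.succ
      (x m.castSucc + h • β (x m.castSucc) + r • matVec (s (x m.castSucc)) z + e))
      ∂(_root_.stdGaussian q) := by
  obtain ⟨C, hC, hG⟩ := hG
  set R := 1 + |h| * K + |r| * K + ‖e‖ with hRdef
  have hR : 0 ≤ R := by positivity
  have hI := integrable_one_add_norm_rpow_stdGaussian q hp
  set I := ∫ z, (1 + ‖z‖) ^ p ∂(_root_.stdGaussian q)
  have hI0 : 0 ≤ I := integral_nonneg fun z => by positivity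
  refine ⟨C * (1 + R ^ p * 2 ^ p * I), by positivity, fun x => ?_⟩
  have hS := iSup_norm_rpow_nonneg m.castSucc x p
  have hSx := le_iSup_norm_rpow m.castSucc x p le_rfl
  set S := ⨆ i : {i : Fin (M + 1) // i ≤ m.castSucc}, ‖x i.1‖ ^ p
  set ξ := x m.castSucc
  have hbound : ∀ z, ‖G (Function.update x m.succ
      (ξ + h • β ξ + r • matVec (s ξ) z + e))‖ ≤
      C * (1 + S + (R * (1 + ‖ξ‖)) ^ p * (1 + ‖z‖) ^ p) := by
    intro z
    refine abs_update_le_of_growth hp.le hC hG x (by positivity) (norm_nonneg z) ?_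
    have h1 : ‖ξ + h • β ξ + r • matVec (s ξ) z + e‖ ≤
        ‖ξ‖ + |h| * (K * (1 + ‖ξ‖)) + |r| * (K * (1 + ‖ξ‖) * ‖z‖) + ‖e‖ := by
      have h₃ : ‖ξ + h • β ξ + r • matVec (s ξ) z‖ ≤ _ := norm_add₃_le
      refine (norm_add_le_of_le h₃ le_rfl).trans ?_
      rw [norm_smul, norm_smul, Real.norm_eq_abs, Real.norm_eq_abs]
      gcongr
      · exact hβ ξ
      · exact (norm_matVec_le _ z).trans (by gcongr; exact hs ξ)
    refine h1.trans ?_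
    have hξ := norm_nonneg ξ
    have hz := norm_nonneg z
    have e1 : ‖ξ‖ ≤ 1 * (1 + ‖ξ‖) * (1 + ‖z‖) := by nlinarith [mul_nonneg hξ hz]
    have e2 : |h| * (K * (1 + ‖ξ‖)) ≤ (|h| * K) * (1 + ‖ξ‖) * (1 + ‖z‖) := by
      have : 0 ≤ (|h| * K) * (1 + ‖ξ‖) * ‖z‖ := by positivity
      linarith
    have e3 : |r| * (K * (1 + ‖ξ‖) * ‖z‖) ≤ (|r| * K) * (1 + ‖ξ‖) * (1 + ‖z‖) := by
      have : 0 ≤ (|r| * K) * (1 + ‖ξ‖) := by positivity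
      linarith
    have e4 : ‖e‖ ≤ ‖e‖ * (1 + ‖ξ‖) * (1 + ‖z‖) := by
      have : 1 ≤ (1 + ‖ξ‖) * (1 + ‖z‖) := by nlinarith [mul_nonneg hξ hz]
      nlinarith [norm_nonneg e]
    rw [hRdef]
    linarith
  have hmaj : Integrable (fun z => C * (1 + S + (R * (1 + ‖ξ‖)) ^ p * (1 + ‖z‖) ^ p))
      (_root_.stdGaussian q) :=
    ((integrable_const _).add (hI.const_mul _)).const_mul _
  have hval : ∫ z, C * (1 + S + (R * (1 + ‖ξ‖)) ^ p * (1 + ‖z‖) ^ p) ∂(_root_.stdGaussian q) =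
      C * (1 + S + (R * (1 + ‖ξ‖)) ^ p * I) := by
    rw [integral_const_mul, integral_add (integrable_const _) (hI.const_mul _),
      integral_const_mul, integral_const]
    simp [I]
  have hpow : (R * (1 + ‖ξ‖)) ^ p ≤ R ^ p * (2 ^ p * (1 + S)) := by
    rw [Real.mul_rpow hR (by positivity)]
    gcongr
    refine (one_add_rpow_le hp.le (norm_nonneg ξ)).trans ?_
    gcongr
  calc _ ≤ C * (1 + S + (R * (1 + ‖ξ‖)) ^ p * I) :=
        (norm_integral_le_of_norm_le hmaj (Filter.Eventually.of_forall hbound)).trans_eq hval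
    _ ≤ C * (1 + S + R ^ p * (2 ^ p * (1 + S)) * I) := by gcongr
    _ = C * (1 + R ^ p * 2 ^ p * I) * (1 + S) := by ring

end Recursion

/-- Properties of the backward recursion `Φ` associated with the Euler scheme of a
McKean–Vlasov equation with common noise, along a fixed realization `z⁰` of the common-noise
increments: each `Φ_m` is finite (the defining integrals converge), convex with `p`-polynomial
growth in the space variables `x₀, …, x_m`, and non-decreasing in the measure arguments
`μ_m, …, μ_M` with respect to the convex order. -/
theorem backward_recursion_convex_and_monotone
    {d q M : ℕ} (hd : 1 ≤ d) (hq : 1 ≤ q) (hM : 1 ≤ M)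
    (p : ℝ) (hp : 2 ≤ p) (T : ℝ) (hT : 0 < T) (h : ℝ) (hhdef : h = T / M)
    -- fixed realization of the rescaled common-noise increments
    (z0 : Fin M → EuclideanSpace ℝ (Fin q))
    -- coefficients
    (b : Fin M → EuclideanSpace ℝ (Fin d) → Measure (EuclideanSpace ℝ (Fin d)) →
      EuclideanSpace ℝ (Fin d))
    (σ : Fin M → EuclideanSpace ℝ (Fin d) → Measure (EuclideanSpace ℝ (Fin d)) →
      Matrix (Fin d) (Fin q) ℝ)
    (σ0 : Fin M → Measure (EuclideanSpace ℝ (Fin d)) → Matrix (Fin d) (Fin q) ℝ)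
    -- (a) measurability in x and the growth bound
    (hmeas : ∀ m μ, MemPp p μ → Measurable (fun x => b m x μ) ∧
      Measurable (fun x => σ m x μ))
    (L : ℝ) (hL : 0 ≤ L)
    (hgrowth : ∀ m x μ, MemPp p μ →
      ‖b m x μ‖ + matOpNorm (σ m x μ) + matOpNorm (σ0 m μ) ≤
        L * (1 + ‖x‖ + (∫ ξ, ‖ξ‖ ^ p ∂μ) ^ (1 / p)))
    -- (b) b is affine in x and constant in μ w.r.t. the convex order
    (hbaffine : ∀ m μ, MemPp p μ → ∀ x y : EuclideanSpace ℝ (Fin d), ∀ t : ℝ,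
      b m (t • x + (1 - t) • y) μ = t • b m x μ + (1 - t) • b m y μ)
    (hbconst : ∀ m x μ ν, MemPp p μ → MemPp p ν → CvOrder μ ν → b m x μ = b m x ν)
    -- (c) σ is convex in x w.r.t. the matrix order
    (hσconv : ∀ m μ, MemPp p μ → ∀ x y : EuclideanSpace ℝ (Fin d), ∀ t ∈ Set.Icc (0:ℝ) 1,
      matLE (σ m (t • x + (1 - t) • y) μ) (t • σ m x μ + (1 - t) • σ m y μ))
    -- (d) σ is non-decreasing in μ w.r.t. the convex order
    (hσmono : ∀ m x μ ν, MemPp p μ → MemPp p ν → CvOrder μ ν → matLE (σ m x μ) (σ m x ν))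
    -- (f) σ⁰ is constant in μ w.r.t. the convex order
    (hσ0const : ∀ m μ ν, MemPp p μ → MemPp p ν → CvOrder μ ν → σ0 m μ = σ0 m ν)
    -- a convex function with p-polynomial growth
    (F : (Fin (M + 1) → EuclideanSpace ℝ (Fin d)) → ℝ)
    (hFconv : ConvexOn ℝ Set.univ F)
    (hFgrowth : ∃ C > 0, ∀ x : Fin (M + 1) → EuclideanSpace ℝ (Fin d),
      |F x| ≤ C * (1 + ⨆ m : Fin (M + 1), ‖x m‖ ^ p))
    -- the backward recursion Φ (in a redundant-arguments form: Φ m x μ only uses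
    -- x₀, …, x_m and μ_m, …, μ_M)
    (Φ : Fin (M + 1) → (Fin (M + 1) → EuclideanSpace ℝ (Fin d)) →
      (Fin (M + 1) → Measure (EuclideanSpace ℝ (Fin d))) → ℝ)
    (hΦlast : ∀ x μ, Φ (Fin.last M) x μ = F x)
    (hΦrec : ∀ m : Fin M, ∀ x μ, Φ m.castSucc x μ =
      ∫ z, Φ m.succ
        (Function.update x m.succ
          (x m.castSucc + h • b m (x m.castSucc) (μ m.castSucc) +
            Real.sqrt h • matVec (σ m (x m.castSucc) (μ m.castSucc)) z +
            Real.sqrt h • matVec (σ0 m (μ m.castSucc)) (z0 m))) μ ∂(stdGaussian q)) :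
    -- (i) finiteness (integrability of the defining integrands), convexity and
    -- p-polynomial growth in the space variables x₀, …, x_m
    ((∀ m : Fin M, ∀ x μ, (∀ i, MemPp p (μ i)) →
      Integrable (fun z => Φ m.succ
        (Function.update x m.succ
          (x m.castSucc + h • b m (x m.castSucc) (μ m.castSucc) +
            Real.sqrt h • matVec (σ m (x m.castSucc) (μ m.castSucc)) z +
            Real.sqrt h • matVec (σ0 m (μ m.castSucc)) (z0 m))) μ) (stdGaussian q)) ∧
     (∀ m : Fin (M + 1), ∀ μ, (∀ i, MemPp p (μ i)) →
      ConvexOn ℝ Set.univ (fun x => Φ m x μ) ∧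
      ∃ C > 0, ∀ x, |Φ m x μ| ≤
        C * (1 + ⨆ i : {i : Fin (M + 1) // i ≤ m}, ‖x i.1‖ ^ p))) ∧
    -- (ii) Φ_m is non-decreasing in μ_m, …, μ_M w.r.t. the convex order
    (∀ m : Fin (M + 1), ∀ x, ∀ μ ν, (∀ i, MemPp p (μ i)) → (∀ i, MemPp p (ν i)) →
      (∀ i, m ≤ i → CvOrder (μ i) (ν i)) → Φ m x μ ≤ Φ m x ν) := by
  have hp0 : 0 < p := by linarith
  have hspace : ∀ m : Fin (M + 1), ∀ μ, (∀ i, MemPp p (μ i)) →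
      ConvexOn ℝ Set.univ (fun x => Φ m x μ) ∧ GrowthUpTo p m (fun x => Φ m x μ) := by
    intro m
    induction m using Fin.reverseInduction with
    | last =>
      intro μ _
      simp only [hΦlast]
      refine ⟨hFconv, ?_⟩
      obtain ⟨C, hC, hF⟩ := hFgrowth
      refine ⟨C, hC, fun x => (hF x).trans ?_⟩
      gcongr
      exact ciSup_le fun i => le_iSup_norm_rpow (Fin.last M) x p (Fin.le_last i)
    | cast m ih =>
      intro μ hμ
      obtain ⟨hconv, hgr⟩ := ih μ hμ
      have hμm := hμ m.castSucc
      have hrec : (fun x => Φ m.castSucc x μ) = fun x => _ := funext fun x => hΦrec m x μ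
      rw [hrec]
      refine ⟨convexOn_integral_update_matVec (G := fun x => Φ m.succ x μ)
        (β := fun x => b m x (μ m.castSucc)) (s := fun x => σ m x (μ m.castSucc)) hp0 hconv hgr
        (hbaffine m _ hμm) (hσconv m _ hμm) h (Real.sqrt h)
        (Real.sqrt h • matVec (σ0 m (μ m.castSucc)) (z0 m)), ?_⟩
      set κ := (∫ ξ, ‖ξ‖ ^ p ∂(μ m.castSucc)) ^ (1 / p)
      have hκ : 0 ≤ κ := Real.rpow_nonneg (integral_nonneg fun ξ => by positivity) _
      have hlin : ∀ x : EuclideanSpace ℝ (Fin d),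
          L * (1 + ‖x‖ + κ) ≤ L * (1 + κ) * (1 + ‖x‖) := fun x => by
        have : 0 ≤ L * (κ * ‖x‖) := by positivity
        linarith
      refine growthUpTo_integral_update_matVec (G := fun x => Φ m.succ x μ)
        (β := fun x => b m x (μ m.castSucc)) (s := fun x => σ m x (μ m.castSucc)) hp0 hgr
        (K := L * (1 + κ)) (by positivity) (fun x => ?_) (fun x => ?_) h (Real.sqrt h)
        (Real.sqrt h • matVec (σ0 m (μ m.castSucc)) (z0 m))
      all_goals
        have h1 := hgrowth m x _ hμm
        have h2 := hlin x
        have h3 := norm_nonneg (b m x (μ m.castSucc))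
        have h4 := matOpNorm_nonneg (σ m x (μ m.castSucc))
        have h5 := matOpNorm_nonneg (σ0 m (μ m.castSucc))
        linarith
  have hint : ∀ m : Fin M, ∀ x μ, (∀ i, MemPp p (μ i)) →
      ∀ c e : EuclideanSpace ℝ (Fin d), ∀ u : Matrix (Fin d) (Fin q) ℝ,
      Integrable (fun z => Φ m.succ
        (Function.update x m.succ (c + Real.sqrt h • matVec u z + e)) μ) (stdGaussian q) :=
    fun m x μ hμ c e u =>
      integrable_update_matVec hp0 (hspace m.succ μ hμ).1 (hspace m.succ μ hμ).2 x c e _ u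
  refine ⟨⟨fun m x μ hμ => hint m x μ hμ _ _ _, hspace⟩, fun m => ?_⟩
  induction m using Fin.reverseInduction with
  | last =>
    intro x μ ν _ _ _
    rw [hΦlast, hΦlast]
  | cast m ih =>
    intro x μ ν hμ hν hle
    have hlem := hle m.castSucc le_rfl
    rw [hΦrec, hΦrec, hbconst m _ _ _ (hμ _) (hν _) hlem, hσ0const m _ _ (hμ _) (hν _) hlem]
    refine (integral_update_matVec_le_of_matLE hp0 (hspace m.succ μ hμ).1 (hspace m.succ μ hμ).2 x
      _ _ _ (hσmono m (x m.castSucc) _ _ (hμ _) (hν _) hlem)).trans ?_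
    refine integral_mono (hint m x μ hμ _ _ _) (hint m x ν hν _ _ _) fun z => ?_
    exact ih _ μ ν hμ hν fun i hi => hle i (m.castSucc_lt_succ.le.trans hi)

end
end
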